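/- Let ε > 0 and let α be an irrational number of type < ψ, where ψ(q) = exp(q^{1/(3+ε)}), i.e. q·⟨qα⟩ ≥ exp(−q^{1/(3+ε)}) for all q ∈ ℕ. Then the discrepancy D_N of the sequence ({nα})_{n≥1} of fractional parts satisfies D_N = O(1/(ln N)^{3+ε/3}), i.e. there is a constant C such that D_N ≤ C/(ln N)^{3+ε/3} for all N ≥ 2. -/

import Mathlib

open MeasureTheory Set Filter
open scoped ENNReal

noncomputable section

open scoped Classical in
/-- The number of indices `n ∈ {1,…,N}` with `ω n ∈ [a,b)`. -/
def discCount (ω : ℕ → ℝ) (N : ℕ) (a b : ℝ) : ℕ :=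
  ((Finset.Icc 1 N).filter fun n => ω n ∈ Set.Ico a b).card

/-- Discrepancy `D_N(ω)` of a sequence `(ω n)_{n ≥ 1}` of points of `[0,1)`. -/
def discrepancy (ω : ℕ → ℝ) (N : ℕ) : ℝ :=
  sSup { d : ℝ | ∃ a b : ℝ, 0 ≤ a ∧ a < b ∧ b ≤ 1 ∧
    d = |(discCount ω N a b : ℝ) / N - (b - a)| }

/-- `⟨t⟩`, the distance from `t` to the nearest integer. -/
def distNearestInt (t : ℝ) : ℝ := |t - round t|

/-- The pairs `(n / q, t)`, with `t` an integer within bounded distance of `q` times the fractional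
part of `n α`, determine `n` when `p / q` is a reduced fraction close to `α`. -/
theorem discCount_fract_mul_le {α : ℝ} {p : ℤ} {q : ℕ} (hq : 0 < q)
    (hcop : IsCoprime (q : ℤ) p) (hclose : (q : ℝ) * |q * α - p| ≤ 1)
    (N : ℕ) {a b : ℝ} (hab : a ≤ b) :
    (discCount (fun n => Int.fract ((n : ℝ) * α)) N a b : ℝ)
      ≤ ((N : ℝ) / q + 1) * (q * (b - a) + 4) := by
  classical
  have hq' : (0 : ℝ) < q := by exact_mod_cast hq
  set t : ℕ → ℤ := fun n =>
    ⌊(q : ℝ) * (q * (n / q : ℕ) * α)⌋ + (n % q : ℕ) * p - q * ⌊(n : ℝ) * α⌋ with ht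
  set T : Finset ℤ := Finset.Icc ⌈q * a - 2⌉ ⌊q * b + 1⌋ with hT
  have hcard : discCount (fun n => Int.fract ((n : ℝ) * α)) N a b
      ≤ (Finset.range (N / q + 1) ×ˢ T).card := by
    unfold discCount
    refine Finset.card_le_card_of_injOn (fun n => (n / q, t n)) ?_ ?_
    · intro n hn
      simp only [Finset.coe_filter, Finset.mem_Icc, Set.mem_ofPred_eq, Set.mem_Ico] at hn
      obtain ⟨⟨-, hnN⟩, hna, hnb⟩ := hn
      have hk : n / q < N / q + 1 := Nat.lt_succ_of_le (Nat.div_le_div_right hnN)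
      have hη : |((n % q : ℕ) : ℝ) * (q * α - p)| ≤ 1 := by
        rw [abs_mul, Nat.abs_cast]
        refine le_trans ?_ hclose
        gcongr
        exact (Nat.mod_lt n hq).le
      have hn : (n : ℝ) = q * (n / q : ℕ) + (n % q : ℕ) := by
        exact_mod_cast (Nat.div_add_mod n q).symm
      have hteq : (t n : ℝ) = q * Int.fract ((n : ℝ) * α)
          - Int.fract ((q : ℝ) * (q * (n / q : ℕ) * α)) - (n % q : ℕ) * (q * α - p) := by
        simp only [ht, Int.fract, Int.cast_sub, Int.cast_add, Int.cast_mul, Int.cast_natCast]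
        have : (q : ℝ) * (n * α) = q * ((q * (n / q : ℕ) + (n % q : ℕ)) * α) := by rw [← hn]
        linear_combination (-1 : ℝ) * this
      have h0 := Int.fract_nonneg ((q : ℝ) * (q * (n / q : ℕ) * α))
      have h1 := Int.fract_lt_one ((q : ℝ) * (q * (n / q : ℕ) * α))
      have hqa := mul_le_mul_of_nonneg_left hna hq'.le
      have hqb := mul_le_mul_of_nonneg_left hnb.le hq'.le
      rw [abs_le] at hη
      simp only [Finset.coe_product, Set.mem_prod, Finset.mem_coe, Finset.mem_range, hT,
        Finset.mem_Icc, Int.ceil_le, Int.le_floor]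
      refine ⟨hk, ?_, ?_⟩ <;> rw [hteq] <;> linarith
    · intro m _ n _ hmn
      simp only [Prod.mk.injEq, ht] at hmn
      obtain ⟨hk, htt⟩ := hmn
      rw [hk] at htt
      have hdvd : (q : ℤ) ∣ ((n % q : ℕ) - (m % q : ℕ) : ℤ) * p :=
        ⟨⌊(n : ℝ) * α⌋ - ⌊(m : ℝ) * α⌋, by linear_combination -htt⟩
      have hmod : m % q ≡ n % q [MOD q] := Nat.modEq_iff_dvd.2 (hcop.dvd_of_dvd_mul_right hdvd)
      have hmod' : m % q = n % q := by simpa [Nat.ModEq] using hmod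
      rw [← Nat.div_add_mod m q, ← Nat.div_add_mod n q, hk, hmod']
  have hTcard : (T.card : ℝ) ≤ q * (b - a) + 4 := by
    have hnonneg : 0 ≤ (q : ℝ) * (b - a) := mul_nonneg hq'.le (sub_nonneg.2 hab)
    have h1 := Int.floor_le ((q : ℝ) * b + 1)
    have h2 := Int.le_ceil ((q : ℝ) * a - 2)
    rw [hT, Int.card_Icc]
    rcases le_total 0 (⌊(q : ℝ) * b + 1⌋ + 1 - ⌈(q : ℝ) * a - 2⌉) with h | h
    · have := congrArg (Int.cast : ℤ → ℝ) (Int.toNat_of_nonneg h)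
      push_cast at this
      rw [this]
      linarith
    · rw [Int.toNat_of_nonpos h]
      push_cast
      linarith
  have hblocks : ((N / q : ℕ) : ℝ) ≤ (N : ℝ) / q := Nat.cast_div_le
  calc (discCount (fun n => Int.fract ((n : ℝ) * α)) N a b : ℝ)
      ≤ ((Finset.range (N / q + 1) ×ˢ T).card : ℝ) := by exact_mod_cast hcard
    _ = ((N / q : ℕ) + 1 : ℝ) * T.card := by
      rw [Finset.card_product, Finset.card_range]
      push_cast
      ring
    _ ≤ ((N : ℝ) / q + 1) * (q * (b - a) + 4) := by gcongr

theorem discCount_add_discCount (ω : ℕ → ℝ) (N : ℕ) {a b c : ℝ} (hab : a ≤ b) (hbc : b ≤ c) :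
    discCount ω N a b + discCount ω N b c = discCount ω N a c := by
  classical
  unfold discCount
  rw [← Finset.card_union_of_disjoint]
  · congr 1
    ext n
    simp only [Finset.mem_union, Finset.mem_filter, ← and_or_left, ← Set.mem_union,
      Set.Ico_union_Ico_eq_Ico hab hbc]
  · refine Finset.disjoint_filter.2 fun n _ h1 h2 => ?_
    exact absurd h1.2 (not_lt.2 h2.1)

theorem discCount_zero_one {ω : ℕ → ℝ} (hω : ∀ n, ω n ∈ Set.Ico (0 : ℝ) 1) (N : ℕ) :
    discCount ω N 0 1 = N := by
  classical
  rw [discCount, Finset.filter_true_of_mem fun n _ => hω n, Nat.card_Icc, Nat.add_sub_cancel]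

/-- A one-sided bound for the counts in all intervals yields a bound for the discrepancy. -/
theorem discrepancy_le_two_mul {ω : ℕ → ℝ} (hω : ∀ n, ω n ∈ Set.Ico (0 : ℝ) 1) {N : ℕ}
    (hN : 0 < N) {E : ℝ} (hE : 0 ≤ E)
    (h : ∀ a b : ℝ, 0 ≤ a → a ≤ b → b ≤ 1 → (discCount ω N a b : ℝ) ≤ N * (b - a + E)) :
    discrepancy ω N ≤ 2 * E := by
  have hN' : (0 : ℝ) < N := by exact_mod_cast hN
  refine Real.sSup_le ?_ (by positivity)
  rintro d ⟨a, b, ha, hab, hb, rfl⟩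
  have hmid := h a b ha hab.le hb
  have hleft := h 0 a le_rfl ha (hab.le.trans hb)
  have hright := h b 1 (ha.trans hab.le) hb le_rfl
  have hsum : (discCount ω N 0 a : ℝ) + discCount ω N a b + discCount ω N b 1 = N := by
    have := discCount_zero_one hω N
    rw [← discCount_add_discCount ω N (ha.trans hab.le) hb,
      ← discCount_add_discCount ω N ha hab.le] at this
    exact_mod_cast this
  have hNE : 0 ≤ N * E := mul_nonneg hN'.le hE
  rw [abs_le]
  constructor
  · rw [le_sub_iff_add_le, le_div_iff₀ hN']
    linarith
  · rw [sub_le_iff_le_add, div_le_iff₀ hN']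
    linarith

/-- If `α` is close to the reduced fraction `p / q`, the discrepancy of the first `N ≥ q ^ 2`
multiples of `α` modulo one is `O(1 / q)`. -/
theorem discrepancy_fract_mul_le {α : ℝ} {p : ℤ} {q : ℕ} (hq : 0 < q)
    (hcop : IsCoprime (q : ℤ) p) (hclose : (q : ℝ) * |q * α - p| ≤ 1)
    {N : ℕ} (hqN : q * q ≤ N) :
    discrepancy (fun n => Int.fract ((n : ℝ) * α)) N ≤ 18 / q := by
  have hq1 : (1 : ℝ) ≤ q := by exact_mod_cast hq
  have hq' : (0 : ℝ) < q := by exact_mod_cast hq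
  have hqN' : (q : ℝ) * q ≤ N := by exact_mod_cast hqN
  have hqdiv : (q : ℝ) ≤ N / q := by rwa [le_div_iff₀ hq']
  have hN : 0 < N := (Nat.mul_pos hq hq).trans_le hqN
  have key := discrepancy_le_two_mul (ω := fun n => Int.fract ((n : ℝ) * α))
    (fun n => ⟨Int.fract_nonneg _, Int.fract_lt_one _⟩) hN (E := 9 / q) (by positivity) ?_
  · calc _ ≤ _ := key
      _ = 18 / q := by ring
  · intro a b ha hab hb
    refine (discCount_fract_mul_le hq hcop hclose N hab).trans ?_
    have hqb : (q : ℝ) * (b - a) ≤ q * 1 := by gcongr; linarith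
    have hexp : ((N : ℝ) / q + 1) * (q * (b - a) + 4)
        = N * (b - a) + 4 * (N / q) + q * (b - a) + 4 := by
      field_simp
      ring
    have hrhs : (N : ℝ) * (b - a + 9 / q) = N * (b - a) + 9 * (N / q) := by ring
    rw [hexp, hrhs]
    linarith

/-- The approximation property forces denominators of good approximations to be large. -/
theorem log_le_of_exp_neg_rpow_le {q y r s : ℝ} (hq : 1 ≤ q) (hy : 0 < y) (hr : 0 < r)
    (hsr : s ≤ r⁻¹) (h : Real.exp (-q ^ s) ≤ q * (1 / y)) :
    Real.log y ≤ (1 + r) * q ^ r⁻¹ := by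
  have hq0 : 0 < q := by linarith
  have hlog := Real.log_le_log (Real.exp_pos _) h
  rw [Real.log_exp, mul_one_div, Real.log_div hq0.ne' hy.ne'] at hlog
  have h1 : q ^ s ≤ q ^ r⁻¹ := Real.rpow_le_rpow_of_exponent_le hq hsr
  have h2 := Real.log_le_rpow_div hq0.le (inv_pos.2 hr)
  rw [div_inv_eq_mul] at h2
  linarith

theorem discrepancy_of_irrational_of_type
    (ε : ℝ) (hε : 0 < ε) (α : ℝ) (hirr : Irrational α)
    (htype : ∀ q : ℕ, 1 ≤ q →
      Real.exp (-(q : ℝ) ^ ((1 : ℝ) / (3 + ε))) ≤ (q : ℝ) * distNearestInt (q * α)) :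
    ∃ C : ℝ, ∀ N : ℕ, 2 ≤ N →
      discrepancy (fun n => Int.fract ((n : ℝ) * α)) N
        ≤ C / (Real.log N) ^ (3 + ε / 3) := by
  obtain ⟨r, hr⟩ : ∃ r, r = 3 + ε / 3 := ⟨_, rfl⟩
  have hr0 : 0 < r := by rw [hr]; positivity
  rw [← hr]
  refine ⟨18 * (2 * (1 + r)) ^ r, fun N hN => ?_⟩
  have hM : 0 < Nat.sqrt N := Nat.sqrt_pos.2 (by omega)
  obtain ⟨x, hx, hxM⟩ := Real.exists_rat_abs_sub_le_and_den_le α hM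
  have hq : 0 < x.den := x.den_pos
  have hq' : (0 : ℝ) < x.den := by exact_mod_cast hq
  have hM' : (0 : ℝ) < (Nat.sqrt N : ℝ) + 1 := by positivity
  have hclose : |(x.den : ℝ) * α - x.num| ≤ 1 / ((Nat.sqrt N : ℝ) + 1) := by
    have hxeq : (x.den : ℝ) * α - x.num = x.den * (α - x) := by
      rw [mul_sub, Rat.cast_def x, mul_div_cancel₀ _ hq'.ne']
    rw [hxeq, abs_mul, Nat.abs_cast]
    calc (x.den : ℝ) * |α - x| ≤ x.den * (1 / ((Nat.sqrt N + 1) * x.den)) := by gcongr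
      _ = 1 / ((Nat.sqrt N : ℝ) + 1) := by field_simp
  have hqM : (x.den : ℝ) ≤ (Nat.sqrt N : ℝ) + 1 := by exact_mod_cast hxM.trans (Nat.le_succ _)
  have hdisc : discrepancy (fun n => Int.fract ((n : ℝ) * α)) N ≤ 18 / x.den := by
    refine discrepancy_fract_mul_le (p := x.num) hq x.isCoprime_num_den.symm ?_
      ((Nat.mul_le_mul hxM hxM).trans (Nat.sqrt_le N))
    calc (x.den : ℝ) * |x.den * α - x.num|
        ≤ (Nat.sqrt N + 1) * (1 / ((Nat.sqrt N : ℝ) + 1)) := by gcongr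
      _ = 1 := mul_one_div_cancel hM'.ne'
  have hlogM : Real.log ((Nat.sqrt N : ℝ) + 1) ≤ (1 + r) * (x.den : ℝ) ^ r⁻¹ := by
    refine log_le_of_exp_neg_rpow_le (by exact_mod_cast hq) hM' hr0 ?_
      ((htype x.den hq).trans ?_)
    · rw [one_div]
      exact inv_anti₀ hr0 (by rw [hr]; linarith)
    · gcongr
      exact (round_le _ x.num).trans hclose
  have hN2 : (2 : ℝ) ≤ N := by exact_mod_cast hN
  have hlogpos : 0 < Real.log N := Real.log_pos (by linarith)
  have hlogN : Real.log N ≤ 2 * (1 + r) * (x.den : ℝ) ^ r⁻¹ := by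
    have hNM : (N : ℝ) ≤ ((Nat.sqrt N : ℝ) + 1) ^ 2 := by
      rw [sq]
      exact_mod_cast (Nat.lt_succ_sqrt N).le
    have := Real.log_le_log (by linarith) hNM
    rw [Real.log_pow] at this
    push_cast at this
    linarith
  have hpow : Real.log N ^ r ≤ (2 * (1 + r)) ^ r * x.den := by
    calc Real.log N ^ r ≤ (2 * (1 + r) * (x.den : ℝ) ^ r⁻¹) ^ r := by gcongr
      _ = (2 * (1 + r)) ^ r * x.den := by
        rw [Real.mul_rpow (by positivity) (by positivity), Real.rpow_inv_rpow hq'.le hr0.ne']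
  refine hdisc.trans ?_
  rw [div_le_div_iff₀ hq' (Real.rpow_pos_of_pos hlogpos r)]
  linarith

end
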